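/- For every q > 2 there exists a constant C > 0, depending only on q (and not on s, t, or f), with the following property. Let s < t be real numbers and let f : ℝ² × [s,t] → ℝ be a smooth function such that there is a compact set K ⊂ ℝ² with f(·,τ) supported in K for every τ ∈ [s,t]. Then ( ∫_s^t ‖f(·,τ)‖_{L^∞(ℝ²)}² dτ )^{1/2} ≤ C ( ∫_s^t ‖∇f(·,τ)‖_{L²(ℝ²)}² dτ )^{1/2} · [ ln( e + ( ∫_s^t ( ‖f(·,τ)‖_{L^q(ℝ²)} + ‖∇f(·,τ)‖_{L^q(ℝ²)} )² dτ )^{1/2} ) ]^{1/2} + C. -/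

import Mathlib

open MeasureTheory Set

noncomputable section

/-- The plane `ℝ²` as a Euclidean space. -/
abbrev E2 := EuclideanSpace ℝ (Fin 2)

def isoE : ℂ ≃ₗᵢ[ℝ] E2 := Complex.orthonormalBasisOneI.repr

def dirW (θ : ℝ) : E2 := isoE (Real.cos θ + Real.sin θ * Complex.I)

lemma norm_dirW (θ : ℝ) : ‖dirW θ‖ = 1 := by
  unfold dirW
  rw [LinearIsometryEquiv.norm_map]
  rw [Complex.ofReal_cos, Complex.ofReal_sin, ← Complex.exp_mul_I, Complex.norm_exp_ofReal_mul_I]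

lemma continuous_dirW : Continuous dirW := by
  unfold dirW
  apply isoE.continuous.comp
  fun_prop

lemma lintegral_polar (F : E2 → ENNReal) (hF : Measurable F) :
    ∫⁻ y, F y = ∫⁻ θ in Ioo (-Real.pi) Real.pi, ∫⁻ r in Ioi (0:ℝ),
      ENNReal.ofReal r * F (r • dirW θ) := by
  have h1 : ∫⁻ y, F y = ∫⁻ z : ℂ, F (isoE z) :=
    ((isoE.measurePreserving).lintegral_comp hF).symm
  have h2 : ∀ p : ℝ × ℝ, isoE (Complex.polarCoord.symm p) = p.1 • dirW p.2 := by
    intro p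
    rw [Complex.polarCoord_symm_apply, dirW, ← map_smul]
    congr 1
  rw [h1, ← Complex.lintegral_comp_polarCoord_symm, polarCoord_target, Measure.volume_eq_prod]
  simp_rw [h2, smul_eq_mul]
  rw [setLIntegral_prod_symm]
  apply Measurable.aemeasurable
  have h3 : Measurable fun p : ℝ × ℝ => p.1 • dirW p.2 :=
    (continuous_fst.smul (continuous_dirW.comp continuous_snd)).measurable
  exact (ENNReal.measurable_ofReal.comp measurable_fst).mul (hF.comp h3)

lemma ray_bound (g : E2 → ℝ) (hg : ContDiff ℝ 1 g) (x w : E2) (hw : ‖w‖ = 1) {R : ℝ}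
    (hR : 0 < R) :
    ‖g x‖ₑ ≤ ∫⁻ r in Ioo 0 R, (‖fderiv ℝ g (x + r • w)‖ₑ
      + ENNReal.ofReal R⁻¹ * ‖g (x + r • w)‖ₑ) := by
  have hd : Differentiable ℝ g := hg.differentiable (by norm_num)
  have hc : Continuous (fderiv ℝ g) := hg.continuous_fderiv (by norm_num)
  have hder : ∀ r : ℝ, HasDerivAt (fun r : ℝ => (1 - R⁻¹ * r) * g (x + r • w))
      ((-R⁻¹) * g (x + r • w) + (1 - R⁻¹ * r) * fderiv ℝ g (x + r • w) w) r := by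
    intro r
    have h1 : HasDerivAt (fun r : ℝ => x + r • w) w r := by
      simpa using ((hasDerivAt_id r).smul_const w).const_add x
    have h2 := (hd (x + r • w)).hasFDerivAt.comp_hasDerivAt r h1
    have h3 : HasDerivAt (fun r : ℝ => 1 - R⁻¹ * r) (-R⁻¹) r := by
      simpa using ((hasDerivAt_id r).const_mul R⁻¹).const_sub 1
    exact h3.mul h2
  have hint := intervalIntegral.integral_eq_sub_of_hasDerivAt (a := 0) (b := R)
    (fun r _ => hder r) (Continuous.intervalIntegrable (by fun_prop) _ _)
  have he : g x = - ∫ r in (0:ℝ)..R,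
      ((-R⁻¹) * g (x + r • w) + (1 - R⁻¹ * r) * fderiv ℝ g (x + r • w) w) := by
    rw [hint]; simp [hR.ne']
  rw [he, enorm_neg, intervalIntegral.integral_of_le hR.le, integral_Ioc_eq_integral_Ioo]
  refine (enorm_integral_le_lintegral_enorm _).trans ?_
  refine setLIntegral_mono' measurableSet_Ioo fun r hr => ?_
  have hR' : 0 < R⁻¹ := inv_pos.2 hR
  have hb : ‖(-R⁻¹) * g (x + r • w) + (1 - R⁻¹ * r) * fderiv ℝ g (x + r • w) w‖ ≤
      ‖fderiv ℝ g (x + r • w)‖ + R⁻¹ * ‖g (x + r • w)‖ := by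
    have h0 : R⁻¹ * r ≤ 1 := by
      rw [inv_mul_le_iff₀ hR]; linarith [hr.2]
    have h1 : 0 ≤ R⁻¹ * r := mul_nonneg hR'.le hr.1.le
    have h2 : ‖fderiv ℝ g (x + r • w) w‖ ≤ ‖fderiv ℝ g (x + r • w)‖ := by
      simpa [hw] using (fderiv ℝ g (x + r • w)).le_opNorm w
    refine (norm_add_le _ _).trans ?_
    rw [norm_mul, norm_mul, norm_neg, Real.norm_of_nonneg hR'.le,
      Real.norm_of_nonneg (by linarith : 0 ≤ 1 - R⁻¹ * r)]
    nlinarith [norm_nonneg (fderiv ℝ g (x + r • w) w)]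
  calc _ = ENNReal.ofReal ‖(-R⁻¹) * g (x + r • w) + (1 - R⁻¹ * r) * fderiv ℝ g (x + r • w) w‖ := (ofReal_norm _).symm
    _ ≤ ENNReal.ofReal (‖fderiv ℝ g (x + r • w)‖ + R⁻¹ * ‖g (x + r • w)‖) :=
      ENNReal.ofReal_le_ofReal hb
    _ = _ := by
      rw [ENNReal.ofReal_add (norm_nonneg _) (by positivity), ENNReal.ofReal_mul (by positivity),
        ofReal_norm, ofReal_norm]

/-- The radial kernel `1/|y|` restricted to `|y| ∈ S`. -/
def kern (S : Set ℝ) (y : E2) : ENNReal := S.indicator (fun r => (ENNReal.ofReal r)⁻¹) ‖y‖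

lemma measurable_kern {S : Set ℝ} (hS : MeasurableSet S) : Measurable (kern S) := by
  have : Measurable (S.indicator (fun r : ℝ => (ENNReal.ofReal r)⁻¹)) :=
    (ENNReal.measurable_ofReal.inv).indicator hS
  exact this.comp measurable_norm

lemma norm_smul_dirW {r : ℝ} (hr : 0 < r) (θ : ℝ) : ‖r • dirW θ‖ = r := by
  rw [norm_smul, norm_dirW, mul_one, Real.norm_of_nonneg hr.le]

lemma kern_rpow {S : Set ℝ} (hS : MeasurableSet S) (hS0 : S ⊆ Ioi 0) {p : ℝ} (hp : 0 < p) :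
    ∫⁻ y, kern S y ^ p = ENNReal.ofReal (2 * Real.pi) * ∫⁻ r in S, ENNReal.ofReal (r ^ (1 - p)) := by
  rw [lintegral_polar _ ((measurable_kern hS).pow_const p)]
  have h : ∀ θ : ℝ, ∫⁻ r in Ioi (0:ℝ), ENNReal.ofReal r * kern S (r • dirW θ) ^ p
      = ∫⁻ r in S, ENNReal.ofReal (r ^ (1 - p)) := by
    intro θ
    have : ∫⁻ r in Ioi (0:ℝ), ENNReal.ofReal r * kern S (r • dirW θ) ^ p =
        ∫⁻ r in Ioi (0:ℝ), S.indicator (fun r => ENNReal.ofReal (r ^ (1 - p))) r := by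
      refine setLIntegral_congr_fun measurableSet_Ioi fun r hr => ?_
      have hr : 0 < r := hr
      simp only [kern, norm_smul_dirW hr]
      by_cases hrS : r ∈ S
      · simp only [indicator_of_mem hrS]
        rw [← ENNReal.ofReal_inv_of_pos hr, ENNReal.ofReal_rpow_of_pos (inv_pos.2 hr),
          ← ENNReal.ofReal_mul hr.le, Real.rpow_sub hr, Real.rpow_one, Real.inv_rpow hr.le]
        rfl
      · simp [indicator_of_notMem hrS, hp]
    rw [this, lintegral_indicator hS, Measure.restrict_restrict hS, inter_eq_left.2 hS0]
  simp_rw [h]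
  rw [setLIntegral_const, Real.volume_Ioo, mul_comm]
  congr 2
  ring

lemma kern_near {p b : ℝ} (hp0 : 0 < p) (hp : p < 2) (hb : 0 < b) :
    ∫⁻ y, kern (Ioo 0 b) y ^ p = ENNReal.ofReal (2 * Real.pi * (b ^ (2 - p) / (2 - p))) := by
  rw [kern_rpow measurableSet_Ioo (fun r hr => hr.1) hp0,
    ENNReal.ofReal_mul (by positivity : (0:ℝ) ≤ 2 * Real.pi)]
  congr 1
  have hi : IntervalIntegrable (fun r : ℝ => r ^ (1 - p)) volume 0 b :=
    intervalIntegral.intervalIntegrable_rpow' (by linarith)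
  rw [← ofReal_integral_eq_lintegral_ofReal]
  · rw [← integral_Ioc_eq_integral_Ioo, ← intervalIntegral.integral_of_le hb.le,
      integral_rpow (Or.inl (by linarith))]
    have : 1 - p + 1 = 2 - p := by ring
    rw [this, Real.zero_rpow (by linarith)]
    simp
  · exact ((intervalIntegrable_iff_integrableOn_Ioo_of_le hb.le).1 hi)
  · filter_upwards [ae_restrict_mem measurableSet_Ioo] with r hr
    exact Real.rpow_nonneg hr.1.le _

lemma kern_mid {a b : ℝ} (ha : 0 < a) (hb : a ≤ b) :
    ∫⁻ y, kern (Ico a b) y ^ (2:ℝ) = ENNReal.ofReal (2 * Real.pi * Real.log (b / a)) := by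
  rw [kern_rpow measurableSet_Ico (fun r hr => ha.trans_le hr.1) two_pos,
    ENNReal.ofReal_mul (by positivity : (0:ℝ) ≤ 2 * Real.pi)]
  congr 1
  have e : ∫⁻ r in Ico a b, ENNReal.ofReal (r ^ (1 - (2:ℝ))) =
      ∫⁻ r in Ico a b, ENNReal.ofReal (r⁻¹) := by
    refine setLIntegral_congr_fun measurableSet_Ico fun r hr => ?_
    have : (1 - (2:ℝ)) = -1 := by norm_num
    simp only [this, Real.rpow_neg_one]
  rw [e]
  have h0 : (0:ℝ) ∉ uIcc a b := by
    rw [uIcc_of_le hb]; exact fun h => absurd h.1 (not_le.2 ha)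
  have hi : IntervalIntegrable (fun r : ℝ => r⁻¹) volume a b :=
    intervalIntegrable_inv_iff.2 (Or.inr h0)
  rw [← ofReal_integral_eq_lintegral_ofReal]
  · rw [integral_Ico_eq_integral_Ioo, ← integral_Ioc_eq_integral_Ioo, ← intervalIntegral.integral_of_le hb,
      integral_inv h0]
  · exact ((intervalIntegrable_iff_integrableOn_Ico_of_le hb).1 hi)
  · filter_upwards [ae_restrict_mem measurableSet_Ico] with r hr
    exact inv_nonneg.2 (ha.le.trans hr.1)

/-- Hölder against the kernel. -/
lemma kern_holder {F : Type*} [NormedAddCommGroup F] {S : Set ℝ} (hS : MeasurableSet S)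
    {p q : ℝ} (hpq : p.HolderConjugate q) (h : E2 → F) (hh : Continuous h) (x : E2) {A : ℝ}
    (hA0 : 0 ≤ A)
    (hA : ∫⁻ y, kern S y ^ p = ENNReal.ofReal A) :
    ∫⁻ y, kern S y * ‖h (x + y)‖ₑ ≤
      ENNReal.ofReal (A ^ (1 / p)) * eLpNorm (fun x => ‖h x‖) (ENNReal.ofReal q) volume := by
  have hm : Measurable fun y => ‖h (x + y)‖ₑ :=
    (Continuous.enorm (by fun_prop)).measurable
  have := ENNReal.lintegral_mul_le_Lp_mul_Lq volume hpq (measurable_kern hS).aemeasurable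
    hm.aemeasurable
  refine this.trans (le_of_eq ?_)
  rw [hA, ENNReal.ofReal_rpow_of_nonneg hA0 (one_div_nonneg.2 hpq.nonneg),
    lintegral_add_left_eq_self (fun y => ‖h y‖ₑ ^ q) x, eLpNorm_norm,
    eLpNorm_eq_lintegral_rpow_enorm_toReal, ENNReal.toReal_ofReal hpq.symm.nonneg]
  · simpa using hpq.symm.pos
  · simp

lemma point_bound (g : E2 → ℝ) (hg : ContDiff ℝ 1 g) (x : E2) {R : ℝ} (hR : 0 < R) :
    ENNReal.ofReal (2 * Real.pi) * ‖g x‖ₑ ≤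
      ∫⁻ y, kern (Ioo 0 R) y * (‖fderiv ℝ g (x + y)‖ₑ + ENNReal.ofReal R⁻¹ * ‖g (x + y)‖ₑ) := by
  have hc : Continuous (fderiv ℝ g) := hg.continuous_fderiv (by norm_num)
  have hc' : Continuous g := hg.continuous
  have m1 : Measurable fun y => ‖fderiv ℝ g (x + y)‖ₑ :=
    (Continuous.enorm (by fun_prop)).measurable
  have m2 : Measurable fun y => ‖g (x + y)‖ₑ := (Continuous.enorm (by fun_prop)).measurable
  have m3 : Measurable fun y => kern (Ioo 0 R) y *
      (‖fderiv ℝ g (x + y)‖ₑ + ENNReal.ofReal R⁻¹ * ‖g (x + y)‖ₑ) :=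
    (measurable_kern measurableSet_Ioo).mul (m1.add (m2.const_mul _))
  rw [lintegral_polar _ m3]
  have h1 : ENNReal.ofReal (2 * Real.pi) * ‖g x‖ₑ =
      ∫⁻ θ in Ioo (-Real.pi) Real.pi, ‖g x‖ₑ := by
    rw [setLIntegral_const, Real.volume_Ioo, mul_comm]
    congr 2
    ring
  rw [h1]
  refine lintegral_mono fun θ => ?_
  refine (ray_bound g hg x (dirW θ) (norm_dirW θ) hR).trans ?_
  refine le_trans (le_of_eq ?_) (lintegral_mono_set (s := Ioo 0 R) (t := Ioi 0) fun r hr => hr.1)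
  refine setLIntegral_congr_fun measurableSet_Ioo fun r hr => ?_
  simp only [kern, norm_smul_dirW hr.1, indicator_of_mem hr]
  rw [← mul_assoc, ENNReal.mul_inv_cancel (by simpa using hr.1) (by simp), one_mul]

lemma static_enn {q : ℝ} (hq : 2 < q) (g : E2 → ℝ) (hg : ContDiff ℝ 1 g) (x : E2) {δ R : ℝ}
    (hδ : 0 < δ) (hδR : δ ≤ R) :
    ENNReal.ofReal (2 * Real.pi) * ‖g x‖ₑ ≤
      ENNReal.ofReal ((2 * Real.pi * (δ ^ (2 - q / (q-1)) / (2 - q / (q-1)))) ^ (1 / (q / (q-1)))) *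
        eLpNorm (fun x => ‖fderiv ℝ g x‖) (ENNReal.ofReal q) volume +
      ENNReal.ofReal ((2 * Real.pi * Real.log (R / δ)) ^ (1 / (2:ℝ))) *
        eLpNorm (fun x => ‖fderiv ℝ g x‖) 2 volume +
      ENNReal.ofReal R⁻¹ * (ENNReal.ofReal
        ((2 * Real.pi * (R ^ (2 - q / (q-1)) / (2 - q / (q-1)))) ^ (1 / (q / (q-1)))) *
        eLpNorm (fun x => g x) (ENNReal.ofReal q) volume) := by
  have hR : 0 < R := hδ.trans_le hδR
  have hconj : (q / (q-1)).HolderConjugate q :=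
    (Real.HolderConjugate.conjExponent (by linarith : 1 < q)).symm
  have hp0 : 0 < q / (q-1) := hconj.pos
  have hp2 : q / (q-1) < 2 := by rw [div_lt_iff₀ (by linarith)]; linarith
  have hc : Continuous (fderiv ℝ g) := hg.continuous_fderiv (by norm_num)
  have hc' : Continuous g := hg.continuous
  have m1 : Measurable fun y => ‖fderiv ℝ g (x + y)‖ₑ :=
    (Continuous.enorm (by fun_prop)).measurable
  have m2 : Measurable fun y => ‖g (x + y)‖ₑ := (Continuous.enorm (by fun_prop)).measurable
  have mk := fun {S : Set ℝ} (hS : MeasurableSet S) => measurable_kern hS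
  refine (point_bound g hg x hR).trans ?_
  have hsplit : ∀ y, kern (Ioo 0 R) y = kern (Ioo 0 δ) y + kern (Ico δ R) y := by
    intro y
    simp only [kern]
    rw [← Ioo_union_Ico_eq_Ioo hδ hδR, indicator_union_of_disjoint]
    exact disjoint_left.2 fun r h1 h2 => absurd h1.2 (not_lt.2 h2.1)
  have e : ∫⁻ y, kern (Ioo 0 R) y * (‖fderiv ℝ g (x + y)‖ₑ + ENNReal.ofReal R⁻¹ * ‖g (x + y)‖ₑ) =
      (∫⁻ y, kern (Ioo 0 δ) y * ‖fderiv ℝ g (x + y)‖ₑ) +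
      (∫⁻ y, kern (Ico δ R) y * ‖fderiv ℝ g (x + y)‖ₑ) +
      ENNReal.ofReal R⁻¹ * ∫⁻ y, kern (Ioo 0 R) y * ‖g (x + y)‖ₑ := by
    have k1 : Measurable fun y => kern (Ioo 0 δ) y * ‖fderiv ℝ g (x + y)‖ₑ :=
      (mk measurableSet_Ioo).mul m1
    have k2 : Measurable fun y => kern (Ico δ R) y * ‖fderiv ℝ g (x + y)‖ₑ :=
      (mk measurableSet_Ico).mul m1
    have k3 : Measurable fun y => kern (Ioo 0 R) y * ‖g (x + y)‖ₑ :=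
      (mk measurableSet_Ioo).mul m2
    have k4 : Measurable fun y => kern (Ioo 0 δ) y * ‖fderiv ℝ g (x + y)‖ₑ +
        kern (Ico δ R) y * ‖fderiv ℝ g (x + y)‖ₑ := k1.add k2
    rw [← lintegral_const_mul _ k3, ← lintegral_add_left k1, ← lintegral_add_left k4]
    refine lintegral_congr fun y => ?_
    rw [mul_add, ← add_mul, ← hsplit]
    ring
  rw [e]
  have hpos : ∀ b : ℝ, 0 < b → 0 ≤ 2 * Real.pi * (b ^ (2 - q / (q-1)) / (2 - q / (q-1))) := by
    intro b hb
    have : 0 < 2 - q / (q-1) := by linarith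
    positivity
  gcongr
  · exact kern_holder measurableSet_Ioo hconj _ hc x (hpos _ hδ) (kern_near hp0 hp2 hδ)
  · have := kern_holder measurableSet_Ico Real.HolderConjugate.two_two _ hc x (mul_nonneg (by positivity) (Real.log_nonneg ((one_le_div hδ).2 hδR))) (kern_mid hδ hδR)
    simpa using this
  · have := kern_holder measurableSet_Ioo hconj _ hc' x (hpos _ hR) (kern_near hp0 hp2 hR)
    rwa [eLpNorm_norm] at this

lemma norm_gradient_eq (g : E2 → ℝ) (x : E2) : ‖gradient g x‖ = ‖fderiv ℝ g x‖ := by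
  unfold gradient
  rw [LinearIsometryEquiv.norm_map]

lemma near_simp {q b : ℝ} (hq : 2 < q) (hb : 0 < b) :
    (2 * Real.pi * (b ^ (2 - q / (q-1)) / (2 - q / (q-1)))) ^ (1 / (q / (q-1))) =
      (2 * Real.pi / (2 - q / (q-1))) ^ (1 / (q / (q-1))) * b ^ (1 - 2 / q) := by
  have hp2 : q / (q-1) < 2 := by rw [div_lt_iff₀ (by linarith)]; linarith
  have h2 : 0 < 2 - q / (q-1) := by linarith
  have e : 2 * Real.pi * (b ^ (2 - q / (q-1)) / (2 - q / (q-1))) =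
    (2 * Real.pi / (2 - q / (q-1))) * b ^ (2 - q / (q-1)) := by ring
  rw [e, Real.mul_rpow (by positivity) (by positivity), ← Real.rpow_mul hb.le]
  congr 2
  have : q - 1 ≠ 0 := by linarith
  have : q ≠ 0 := by linarith
  field_simp
  ring

lemma static_real (q : ℝ) (hq : 2 < q) : ∃ C > 0, ∀ N : ℝ, Real.exp 1 ≤ N → ∀ g : E2 → ℝ,
    ContDiff ℝ 1 g → HasCompactSupport g →
    (eLpNorm (fun x => g x) ⊤ volume).toReal ≤
      C * (N⁻¹ * ((eLpNorm (fun x => g x) (ENNReal.ofReal q) volume).toReal +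
        (eLpNorm (fun x => ‖gradient g x‖) (ENNReal.ofReal q) volume).toReal) +
        Real.sqrt (Real.log N) * (eLpNorm (fun x => ‖gradient g x‖) 2 volume).toReal) := by
  have hp2 : q / (q-1) < 2 := by rw [div_lt_iff₀ (by linarith)]; linarith
  have h2p : 0 < 2 - q / (q-1) := by linarith
  set c : ℝ := (2 * Real.pi / (2 - q / (q-1))) ^ (1 / (q / (q-1))) with hc
  have hcpos : 0 < c := by positivity
  set a : ℝ := 1 - 2 / q with ha
  set b : ℝ := 2 / q with hb
  have hbpos : 0 < b := by positivity
  have hapos : 0 < a := by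
    have : 2 / q < 1 := by rw [div_lt_one (by linarith)]; exact hq
    linarith
  set d : ℝ := Real.sqrt (2 * Real.pi * (1 / a + 1 / b)) with hd
  have hd0 : 0 ≤ d := Real.sqrt_nonneg _
  refine ⟨c + d, by positivity, ?_⟩
  intro N hN g hg hs
  have hN1 : 1 ≤ N := le_trans (by simpa using Real.add_one_le_exp (0:ℝ) |>.trans (Real.exp_le_exp.2 zero_le_one)) hN
  have hN0 : 0 < N := by linarith
  have hlog : 0 ≤ Real.log N := Real.log_nonneg hN1
  simp_rw [norm_gradient_eq]
  have hgc : Continuous g := hg.continuous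
  have hfc : Continuous (fderiv ℝ g) := hg.continuous_fderiv (by norm_num)
  have hfs : HasCompactSupport (fderiv ℝ g) := hs.fderiv ℝ
  have n1 : eLpNorm (fun x => g x) (ENNReal.ofReal q) volume ≠ ⊤ :=
    (hgc.memLp_of_hasCompactSupport hs).eLpNorm_ne_top
  have n2 : eLpNorm (fun x => ‖fderiv ℝ g x‖) (ENNReal.ofReal q) volume ≠ ⊤ :=
    (hfc.memLp_of_hasCompactSupport hfs).norm.eLpNorm_ne_top
  have n3 : eLpNorm (fun x => ‖fderiv ℝ g x‖) 2 volume ≠ ⊤ :=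
    (hfc.memLp_of_hasCompactSupport hfs).norm.eLpNorm_ne_top
  have key := fun x => static_enn hq g hg x (δ := N ^ (-(1 / a))) (R := N ^ (1 / b))
    (by positivity) (Real.rpow_le_rpow_of_exponent_le hN1 (by
      have : 0 < 1 / a := by positivity
      have : 0 < 1 / b := by positivity
      linarith))
  rw [near_simp hq (by positivity), near_simp hq (by positivity)] at key
  set A := eLpNorm (fun x => g x) (ENNReal.ofReal q) volume
  set B := eLpNorm (fun x => ‖fderiv ℝ g x‖) (ENNReal.ofReal q) volume
  set G := eLpNorm (fun x => ‖fderiv ℝ g x‖) 2 volume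
  have e1 : (N ^ (-(1 / a))) ^ (1 - 2 / q) = N⁻¹ := by
    rw [← ha, ← Real.rpow_mul hN0.le, ← Real.rpow_neg_one]
    congr 1; field_simp
  have e2 : (N ^ (1 / b))⁻¹ * (N ^ (1 / b)) ^ (1 - 2 / q) = N⁻¹ := by
    rw [← ha, ← Real.rpow_neg hN0.le, ← Real.rpow_mul hN0.le, ← Real.rpow_add hN0, ← Real.rpow_neg_one]
    congr 1
    have : a = 1 - b := rfl
    rw [this]; field_simp; ring
  have e3 : (2 * Real.pi * Real.log (N ^ (1 / b) / N ^ (-(1 / a)))) ^ (1 / (2:ℝ)) =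
      d * Real.sqrt (Real.log N) := by
    rw [← Real.sqrt_eq_rpow, ← Real.rpow_sub hN0, Real.log_rpow hN0, hd,
      ← Real.sqrt_mul (by positivity)]
    congr 1; ring
  have hAn : 0 ≤ A.toReal := ENNReal.toReal_nonneg
  have hBn : 0 ≤ B.toReal := ENNReal.toReal_nonneg
  have hGn : 0 ≤ G.toReal := ENNReal.toReal_nonneg
  have hNi : 0 ≤ N⁻¹ := by positivity
  have hsq := Real.sqrt_nonneg (Real.log N)
  have hbound : ∀ x, ‖g x‖ ≤ (c + d) * (N⁻¹ * (A.toReal + B.toReal) +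
      Real.sqrt (Real.log N) * G.toReal) := by
    intro x
    have h := key x
    rw [e1, e3, ← hc, ← mul_assoc, ← ENNReal.ofReal_mul (by positivity)] at h
    have e4 : (N ^ (1 / b))⁻¹ * (c * (N ^ (1 / b)) ^ (1 - 2 / q)) = c * N⁻¹ := by
      rw [← e2]; ring
    rw [e4, ← ENNReal.ofReal_toReal n1, ← ENNReal.ofReal_toReal n2, ← ENNReal.ofReal_toReal n3,
      ← ofReal_norm, ← ENNReal.ofReal_mul (by positivity), ← ENNReal.ofReal_mul (by positivity),
      ← ENNReal.ofReal_mul (by positivity), ← ENNReal.ofReal_mul (by positivity),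
      ← ENNReal.ofReal_add (by positivity) (by positivity),
      ← ENNReal.ofReal_add (by positivity) (by positivity),
      ENNReal.ofReal_le_ofReal_iff (by positivity)] at h
    have hpi : 1 ≤ 2 * Real.pi := by linarith [Real.pi_gt_three]
    have h5 : ‖g x‖ ≤ 2 * Real.pi * ‖g x‖ := le_mul_of_one_le_left (norm_nonneg _) hpi
    have h6 : 0 ≤ d * (N⁻¹ * (A.toReal + B.toReal)) := by positivity
    have h7 : 0 ≤ c * (Real.sqrt (Real.log N) * G.toReal) := by positivity
    nlinarith
  apply ENNReal.toReal_le_of_le_ofReal (by positivity)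
  rw [eLpNorm_exponent_top]
  exact eLpNormEssSup_le_of_ae_bound (Filter.Eventually.of_forall hbound)

lemma cont_eLpNorm {I : Set ℝ} {K : Set E2} (hK : IsCompact K) {q : ℝ} (hq : 0 < q)
    (h : ℝ → E2 → ℝ) (hc : ContinuousOn (Function.uncurry h) (I ×ˢ univ))
    (h0 : ∀ τ x, τ ∈ I → x ∉ K → h τ x = 0) :
    ContinuousOn (fun τ => (eLpNorm (h τ) (ENNReal.ofReal q) volume).toReal) I := by
  have hint : ContinuousOn (fun τ => ∫ x, ‖h τ x‖ ^ q) I := by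
    apply continuousOn_integral_of_compact_support hK
    · exact (hc.norm).rpow_const (fun _ _ => Or.inr hq.le)
    · intro τ x hτ hx
      simp [h0 τ x hτ hx, Real.zero_rpow hq.ne']
  have h2 := hint.rpow_const (p := q⁻¹) (fun _ _ => Or.inr (by positivity))
  refine h2.congr fun τ hτ => ?_
  have hcτ : Continuous (h τ) := by
    have : ContinuousOn (fun x => Function.uncurry h (τ, x)) univ :=
      hc.comp (by fun_prop) (fun x _ => ⟨hτ, mem_univ _⟩)
    exact continuousOn_univ.1 this
  have hs : HasCompactSupport (h τ) := HasCompactSupport.intro hK fun x hx => h0 τ x hτ hx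
  have hm : MemLp (h τ) (ENNReal.ofReal q) volume := hcτ.memLp_of_hasCompactSupport hs
  simp only
  rw [hm.eLpNorm_eq_integral_rpow_norm (by simpa using hq) (by simp),
    ENNReal.toReal_ofReal hq.le, ENNReal.toReal_ofReal]
  positivity

/-- **Time-integrated logarithmic Sobolev inequality in dimension two** (Lemma 2.2 of the paper,
stated on `D = ℝ²`).  For every `q > 2` there is a constant `C > 0` depending only on `q`
(not on `s`, `t`, or `f`) such that for all `s < t` and every smooth `f : ℝ² × [s,t] → ℝ`
whose spatial supports are contained in a fixed compact set,
`(∫_s^t ‖f(·,τ)‖_{L^∞}² dτ)^{1/2} ≤ C (∫_s^t ‖∇f(·,τ)‖_{L²}² dτ)^{1/2} ·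
  (ln(e + (∫_s^t (‖f(·,τ)‖_{L^q} + ‖∇f(·,τ)‖_{L^q})² dτ)^{1/2}))^{1/2} + C`. -/
theorem log_sobolev_plane_time_integrated (q : ℝ) (hq : 2 < q) :
    ∃ C > 0, ∀ s t : ℝ, s < t →
      ∀ f : E2 → ℝ → ℝ,
        ContDiffOn ℝ (⊤ : ℕ∞) (fun p : E2 × ℝ => f p.1 p.2) (Set.univ ×ˢ Set.Icc s t) →
        (∃ K : Set E2, IsCompact K ∧ ∀ τ ∈ Set.Icc s t, ∀ x, x ∉ K → f x τ = 0) →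
        Real.sqrt (∫ τ in s..t, ((eLpNorm (fun x => f x τ) ⊤ volume).toReal) ^ 2) ≤
          C * Real.sqrt (∫ τ in s..t,
              ((eLpNorm (fun x => ‖gradient (fun y => f y τ) x‖) 2 volume).toReal) ^ 2) *
            Real.sqrt (Real.log (Real.exp 1 + Real.sqrt (∫ τ in s..t,
              ((eLpNorm (fun x => f x τ) (ENNReal.ofReal q) volume).toReal +
               (eLpNorm (fun x => ‖gradient (fun y => f y τ) x‖)
                  (ENNReal.ofReal q) volume).toReal) ^ 2))) + C := by
  obtain ⟨C, hC, hst⟩ := static_real q hq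
  refine ⟨Real.sqrt 2 * C, by positivity, ?_⟩
  rintro s t hlt f hf ⟨K, hK, h0⟩
  set F : E2 × ℝ → ℝ := fun p => f p.1 p.2 with hF
  set T : Set (E2 × ℝ) := univ ×ˢ Icc s t with hT
  have hud : UniqueDiffOn ℝ T := uniqueDiffOn_univ.prod (uniqueDiffOn_Icc hlt)
  have hFd : ContinuousOn (fderivWithin ℝ F T) T :=
    hf.continuousOn_fderivWithin hud (by norm_num)
  have hfd : ∀ τ ∈ Icc s t, ∀ x, HasFDerivAt (fun y => f y τ)
      ((fderivWithin ℝ F T (x, τ)).comp (ContinuousLinearMap.inl ℝ E2 ℝ)) x := by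
    intro τ hτ x
    have h1 : HasFDerivWithinAt F (fderivWithin ℝ F T (x, τ)) T (x, τ) :=
      ((hf.differentiableOn (by norm_num)) (x, τ) ⟨mem_univ _, hτ⟩).hasFDerivWithinAt
    have h2 : HasFDerivWithinAt (fun y : E2 => (y, τ)) (ContinuousLinearMap.inl ℝ E2 ℝ) univ x :=
      (hasFDerivAt_prodMk_left x τ).hasFDerivWithinAt
    have hmt : MapsTo (fun y : E2 => (y, τ)) univ T := fun y _ => ⟨mem_univ _, hτ⟩
    have h3 := HasFDerivWithinAt.comp x h1 h2 hmt
    exact hasFDerivWithinAt_univ.1 h3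
  have hcd : ∀ τ ∈ Icc s t, ContDiff ℝ 1 (fun y => f y τ) := by
    intro τ hτ
    have h2 : ContDiff ℝ 1 (fun y : E2 => (y, τ)) := by fun_prop
    have h3 := (hf.of_le (by norm_num : (1 : WithTop ℕ∞) ≤ ((⊤ : ℕ∞) : WithTop ℕ∞))).comp
      h2.contDiffOn (s := univ) (fun y _ => ⟨mem_univ _, hτ⟩)
    exact contDiffOn_univ.1 h3
  have hcs : ∀ τ ∈ Icc s t, HasCompactSupport (fun y => f y τ) := fun τ hτ =>
    HasCompactSupport.intro hK (h0 τ hτ)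
  have hgrad0 : ∀ τ x, τ ∈ Icc s t → x ∉ K → ‖gradient (fun y => f y τ) x‖ = 0 := by
    intro τ x hτ hx
    rw [norm_gradient_eq]
    have : (fun y => f y τ) =ᶠ[nhds x] fun _ => 0 := by
      filter_upwards [hK.isClosed.isOpen_compl.mem_nhds hx] with y hy
      exact h0 τ hτ y hy
    rw [this.fderiv_eq]
    simp
  have hswap : MapsTo (Prod.swap : ℝ × E2 → E2 × ℝ) (Icc s t ×ˢ univ) T :=
    fun p hp => ⟨mem_univ _, hp.1⟩
  have hc1 : ContinuousOn (Function.uncurry fun τ x => f x τ) (Icc s t ×ˢ univ) :=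
    hf.continuousOn.comp continuous_swap.continuousOn hswap
  have hc2 : ContinuousOn (Function.uncurry fun τ x => ‖gradient (fun y => f y τ) x‖)
      (Icc s t ×ˢ univ) := by
    have h1 : ContinuousOn (fun p : ℝ × E2 => ‖(fderivWithin ℝ F T p.swap).comp
        (ContinuousLinearMap.inl ℝ E2 ℝ)‖) (Icc s t ×ˢ univ) :=
      ((hFd.comp continuous_swap.continuousOn hswap).clm_comp continuousOn_const).norm
    refine h1.congr fun p hp => ?_
    simp only [Function.uncurry]
    rw [norm_gradient_eq, (hfd p.1 hp.1 p.2).fderiv]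
    rfl
  have hq0 : 0 < q := by linarith
  have cA := cont_eLpNorm hK hq0 _ hc1 (fun τ x hτ hx => h0 τ hτ x hx)
  have cB := cont_eLpNorm hK hq0 _ hc2 hgrad0
  have cG := cont_eLpNorm hK two_pos _ hc2 hgrad0
  rw [ENNReal.ofReal_ofNat] at cG
  set u : ℝ → ℝ := fun τ => (eLpNorm (fun x => f x τ) ⊤ volume).toReal with hu
  set G : ℝ → ℝ := fun τ => (eLpNorm (fun x => ‖gradient (fun y => f y τ) x‖) 2 volume).toReal
    with hG
  set m : ℝ → ℝ := fun τ => (eLpNorm (fun x => f x τ) (ENNReal.ofReal q) volume).toReal +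
    (eLpNorm (fun x => ‖gradient (fun y => f y τ) x‖) (ENNReal.ofReal q) volume).toReal with hm
  have cm : ContinuousOn m (Icc s t) := cA.add cB
  change Real.sqrt (∫ τ in s..t, u τ ^ 2) ≤ Real.sqrt 2 * C * Real.sqrt (∫ τ in s..t, G τ ^ 2) *
    Real.sqrt (Real.log (Real.exp 1 + Real.sqrt (∫ τ in s..t, m τ ^ 2))) + Real.sqrt 2 * C
  set M := Real.sqrt (∫ τ in s..t, m τ ^ 2) with hM
  set N := Real.exp 1 + M with hN
  have hM0 : 0 ≤ M := Real.sqrt_nonneg _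
  have hNe : Real.exp 1 ≤ N := by linarith
  have hN0 : 0 < N := (Real.exp_pos 1).trans_le hNe
  have hlog : 0 ≤ Real.log N := Real.log_nonneg (by linarith [Real.add_one_le_exp (1:ℝ)])
  have hst' : ∀ τ ∈ Icc s t, u τ ≤ C * (N⁻¹ * m τ + Real.sqrt (Real.log N) * G τ) :=
    fun τ hτ => hst N hNe _ (hcd τ hτ) (hcs τ hτ)
  have im : IntervalIntegrable (fun τ => m τ ^ 2) volume s t :=
    ContinuousOn.intervalIntegrable_of_Icc hlt.le (cm.pow 2)
  have iG : IntervalIntegrable (fun τ => G τ ^ 2) volume s t :=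
    ContinuousOn.intervalIntegrable_of_Icc hlt.le (cG.pow 2)
  have hmain : ∫ τ in s..t, u τ ^ 2 ≤ ∫ τ in s..t,
      (2 * C ^ 2 * N⁻¹ ^ 2 * m τ ^ 2 + 2 * C ^ 2 * Real.log N * G τ ^ 2) := by
    rw [intervalIntegral.integral_of_le hlt.le, intervalIntegral.integral_of_le hlt.le]
    refine integral_mono_of_nonneg (Filter.Eventually.of_forall fun τ => sq_nonneg _) ?_ ?_
    · exact ((im.const_mul _).add (iG.const_mul _)).1
    · filter_upwards [ae_restrict_mem measurableSet_Ioc] with τ hτ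
      have h1 := hst' τ (Ioc_subset_Icc_self hτ)
      have h2 : 0 ≤ u τ := ENNReal.toReal_nonneg
      have h3 : u τ ^ 2 ≤ (C * (N⁻¹ * m τ + Real.sqrt (Real.log N) * G τ)) ^ 2 :=
        pow_le_pow_left₀ h2 h1 2
      have h4 : Real.sqrt (Real.log N) ^ 2 = Real.log N := Real.sq_sqrt hlog
      have h5 : 0 ≤ C ^ 2 * (N⁻¹ * m τ - Real.sqrt (Real.log N) * G τ) ^ 2 := by positivity
      change u τ ^ 2 ≤ 2 * C ^ 2 * N⁻¹ ^ 2 * m τ ^ 2 + 2 * C ^ 2 * Real.log N * G τ ^ 2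
      rw [← h4]
      nlinarith
  rw [intervalIntegral.integral_add (im.const_mul _) (iG.const_mul _),
    intervalIntegral.integral_const_mul, intervalIntegral.integral_const_mul] at hmain
  have hMi : 0 ≤ ∫ τ in s..t, m τ ^ 2 :=
    intervalIntegral.integral_nonneg hlt.le fun _ _ => sq_nonneg _
  have hGi : 0 ≤ ∫ τ in s..t, G τ ^ 2 :=
    intervalIntegral.integral_nonneg hlt.le fun _ _ => sq_nonneg _
  have hMs : M ^ 2 = ∫ τ in s..t, m τ ^ 2 := Real.sq_sqrt hMi
  have hGs := Real.sq_sqrt hGi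
  have hLs := Real.sq_sqrt hlog
  have h2s : Real.sqrt 2 ^ 2 = 2 := Real.sq_sqrt (by norm_num)
  set g := Real.sqrt (∫ τ in s..t, G τ ^ 2)
  set L := Real.sqrt (Real.log N)
  have hg0 : 0 ≤ g := Real.sqrt_nonneg _
  have hL0 : 0 ≤ L := Real.sqrt_nonneg _
  apply Real.sqrt_le_iff.2
  refine ⟨by positivity, hmain.trans ?_⟩
  rw [← hMs, ← hGs, ← hLs]
  have hNM : N⁻¹ * M ≤ 1 := by
    rw [inv_mul_le_iff₀ hN0]; linarith [Real.exp_pos 1]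
  have hNM2 : (N⁻¹ * M) ^ 2 ≤ 1 := pow_le_one₀ (by positivity) hNM
  have e : (Real.sqrt 2 * C * g * L + Real.sqrt 2 * C) ^ 2 = 2 * C ^ 2 * (g * L + 1) ^ 2 := by
    calc _ = Real.sqrt 2 ^ 2 * C ^ 2 * (g * L + 1) ^ 2 := by ring
      _ = _ := by rw [h2s]
  rw [e]
  have hgL : 0 ≤ g * L := by positivity
  have : (N⁻¹ * M) ^ 2 + (g * L) ^ 2 ≤ (g * L + 1) ^ 2 := by nlinarith
  calc _ = 2 * C ^ 2 * ((N⁻¹ * M) ^ 2 + (g * L) ^ 2) := by ring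
    _ ≤ _ := by gcongr
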